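/- arXiv:2403.18534 — 2 statements merged into one kernel-verified Lean document; each statement's English description precedes it below -/
import Mathlib

section
/- For n ≥ 5, in the unbiased Waiter-Client game on the edges of K_n, Waiter has a strategy to force Client's graph to contain a Hamilton path within n−1 rounds, moreover such that one endpoint of the path is incident with at most two of Waiter's (blue) edges. -/
open SimpleGraph

open scoped Classical

/-- `WaiterForcesIn goal t free client` means that in the unbiased Waiter-Client
game with set `free` of unclaimed elements and set `client` of Client's (red)
elements, Waiter can force, within at most `t` further rounds and against any
play of Client, a position in which `goal client free` holds. -/
inductive WaiterForcesIn {α : Type*} [DecidableEq α]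
    (goal : Finset α → Finset α → Prop) : ℕ → Finset α → Finset α → Prop
  | win {t : ℕ} {free client : Finset α} :
      goal client free → WaiterForcesIn goal t free client
  | offer {t : ℕ} {free client : Finset α} (e₁ e₂ : α)
      (h₁ : e₁ ∈ free) (h₂ : e₂ ∈ free) (hne : e₁ ≠ e₂)
      (hc₁ : WaiterForcesIn goal t (free \ {e₁, e₂}) (insert e₁ client))
      (hc₂ : WaiterForcesIn goal t (free \ {e₁, e₂}) (insert e₂ client)) :
      WaiterForcesIn goal (t + 1) free client

/-- Shorthand for the winning condition of the theorem. -/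
def HGoal (n : ℕ) (client free : Finset (Sym2 (Fin n))) : Prop :=
  ∃ (a b : Fin n)
    (p : (SimpleGraph.fromEdgeSet (↑client : Set (Sym2 (Fin n)))).Walk a b),
    p.IsHamiltonian ∧
    ((((⊤ : SimpleGraph (Fin n)).edgeFinset \ free) \ client).filter
        (fun e => b ∈ e)).card ≤ 2

/-- The number of blue edges at a vertex. -/
def blueDeg (n : ℕ) (client free : Finset (Sym2 (Fin n))) (b : Fin n) : ℕ :=
  ((((⊤ : SimpleGraph (Fin n)).edgeFinset \ free) \ client).filter
        (fun e => b ∈ e)).card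

lemma blueDeg_step {n : ℕ} {client free : Finset (Sym2 (Fin n))} {e f : Sym2 (Fin n)} {b : Fin n} :
    blueDeg n (insert e client) (free \ {e, f}) b ≤ blueDeg n client free b + 1 := by
  unfold blueDeg
  refine le_trans (Finset.card_le_card (t := insert f _) ?_) (Finset.card_insert_le _ _)
  intro x hx
  simp only [Finset.mem_filter, Finset.mem_sdiff, Finset.mem_insert, Finset.mem_singleton] at hx ⊢
  tauto

lemma blueDeg_step_of_notMem {n : ℕ} {client free : Finset (Sym2 (Fin n))} {e f : Sym2 (Fin n)}
    {b : Fin n} (h : b ∉ f) :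
    blueDeg n (insert e client) (free \ {e, f}) b ≤ blueDeg n client free b := by
  unfold blueDeg
  refine Finset.card_le_card ?_
  intro x hx
  simp only [Finset.mem_filter, Finset.mem_sdiff, Finset.mem_insert, Finset.mem_singleton] at hx ⊢
  have : x ≠ f := by rintro rfl; exact h hx.2
  tauto

/-- One extension step of the path at its end `a`. -/
lemma path_step {n : ℕ} {client : Finset (Sym2 (Fin n))} {a b u : Fin n}
    (p : (SimpleGraph.fromEdgeSet (↑client : Set (Sym2 (Fin n)))).Walk a b) (hp : p.IsPath)
    (hu : u ∉ p.support) :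
    ∃ q : (SimpleGraph.fromEdgeSet (↑(insert s(a, u) client) : Set (Sym2 (Fin n)))).Walk b u,
      q.IsPath ∧ ∀ v, v ∈ q.support ↔ v = u ∨ v ∈ p.support := by
  have hle : SimpleGraph.fromEdgeSet (↑client : Set (Sym2 (Fin n))) ≤
      SimpleGraph.fromEdgeSet (↑(insert s(a, u) client) : Set (Sym2 (Fin n))) := by
    apply SimpleGraph.fromEdgeSet_mono
    simp
  have hau : u ≠ a := by rintro rfl; exact hu p.start_mem_support
  have hadj : (SimpleGraph.fromEdgeSet
      (↑(insert s(a, u) client) : Set (Sym2 (Fin n)))).Adj u a := by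
    simp [SimpleGraph.fromEdgeSet_adj, hau, Sym2.eq_swap]
  refine ⟨(SimpleGraph.Walk.cons hadj (p.mapLe hle)).reverse, ?_, ?_⟩
  · rw [SimpleGraph.Walk.isPath_reverse_iff, SimpleGraph.Walk.cons_isPath_iff]
    refine ⟨by simpa using hp, by simpa using hu⟩
  · intro v
    simp only [SimpleGraph.Walk.support_reverse, SimpleGraph.Walk.support_cons, List.mem_reverse,
      List.mem_cons, SimpleGraph.Walk.support_mapLe_eq_support]

lemma extend_path {n : ℕ} : ∀ (k : ℕ) (client free : Finset (Sym2 (Fin n))) (a b : Fin n)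
    (p : (SimpleGraph.fromEdgeSet (↑client : Set (Sym2 (Fin n)))).Walk a b), p.IsPath → a ≠ b →
    p.support.length + k = n →
    (∀ u, u ∉ p.support → s(a, u) ∈ free ∧ s(b, u) ∈ free) →
    (∀ u v, u ∉ p.support → v ∉ p.support → u ≠ v → s(u, v) ∈ free) →
    (∀ u, u ∉ p.support → blueDeg n client free u ≤ 1) →
    blueDeg n client free b ≤ 2 →
    WaiterForcesIn (HGoal n) k free client := by
  intro k
  induction k with
  | zero =>
    intro client free a b p hp hab hlen _ _ _ hb
    refine .win ⟨a, b, p, hp.isHamiltonian_of_mem ?_, hb⟩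
    intro w
    have h1 : p.support.toFinset = Finset.univ := by
      apply Finset.eq_univ_of_card
      rw [List.toFinset_card_of_nodup hp.support_nodup, Fintype.card_fin]
      omega
    have := Finset.mem_univ w
    rw [← h1] at this
    simpa using this
  | succ k ih =>
    intro client free a b p hp hab hlen h1 h2 h3 hb
    obtain ⟨u, hu⟩ : ∃ u, u ∉ p.support := by
      by_contra! hcon
      have h1 : p.support.toFinset = Finset.univ := by
        ext w; simp [hcon w]
      have := congrArg Finset.card h1
      rw [List.toFinset_card_of_nodup hp.support_nodup, Finset.card_univ, Fintype.card_fin] at this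
      omega
    have hua : u ≠ a := by rintro rfl; exact hu p.start_mem_support
    have hub : u ≠ b := by rintro rfl; exact hu p.end_mem_support
    have key : ∀ (a b : Fin n)
        (p : (SimpleGraph.fromEdgeSet (↑client : Set (Sym2 (Fin n)))).Walk a b), p.IsPath → a ≠ b →
        p.support.length + (k + 1) = n →
        (∀ u, u ∉ p.support → s(a, u) ∈ free ∧ s(b, u) ∈ free) →
        (∀ u v, u ∉ p.support → v ∉ p.support → u ≠ v → s(u, v) ∈ free) →
        (∀ u, u ∉ p.support → blueDeg n client free u ≤ 1) → u ∉ p.support →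
        WaiterForcesIn (HGoal n) k (free \ {s(a, u), s(b, u)}) (insert s(a, u) client) := by
      clear hub hua hu hb h3 h2 h1 hlen hab hp p a b
      intro a b p hp hab hlen h1 h2 h3 hu
      have hua : u ≠ a := by rintro rfl; exact hu p.start_mem_support
      have hub : u ≠ b := by rintro rfl; exact hu p.end_mem_support
      obtain ⟨q, hq, hs⟩ := path_step p hp hu
      have hlq : q.support.length = p.support.length + 1 := by
        rw [← List.toFinset_card_of_nodup hq.support_nodup,
          ← List.toFinset_card_of_nodup hp.support_nodup,
          ← Finset.card_insert_of_notMem (a := u) (by simpa using hu)]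
        congr 1
        ext v; simp [hs]
      refine ih _ _ b u q hq hub.symm (by omega) ?_ ?_ ?_ ?_
      · intro v hv
        rw [hs] at hv
        push Not at hv
        have hva : v ≠ a := by rintro rfl; exact hv.2 p.start_mem_support
        have hvb : v ≠ b := by rintro rfl; exact hv.2 p.end_mem_support
        have := hv.1
        refine ⟨?_, ?_⟩
        · have := (h1 v hv.2).2
          simp only [Finset.mem_sdiff, Finset.mem_insert, Finset.mem_singleton, Sym2.eq_iff]
          grind
        · have := h2 u v hu hv.2 (Ne.symm hv.1)
          simp only [Finset.mem_sdiff, Finset.mem_insert, Finset.mem_singleton, Sym2.eq_iff]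
          grind
      · intro v w hv hw hvw
        rw [hs] at hv hw
        push Not at hv hw
        have := h2 v w hv.2 hw.2 hvw
        simp only [Finset.mem_sdiff, Finset.mem_insert, Finset.mem_singleton, Sym2.eq_iff]
        grind
      · intro v hv
        rw [hs] at hv
        push Not at hv
        have hvb : v ≠ b := by rintro rfl; exact hv.2 p.end_mem_support
        refine (blueDeg_step_of_notMem ?_).trans (h3 v hv.2)
        simp [hvb, hv.1]
      · have := h3 u hu
        have := blueDeg_step (client := client) (free := free) (e := s(a, u)) (f := s(b, u)) (b := u)
        omega
    refine .offer s(a, u) s(b, u) (h1 u hu).1 (h1 u hu).2 ?_ ?_ ?_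
    · rw [Ne, Sym2.eq_iff]; grind
    · exact key a b p hp hab hlen h1 h2 h3 hu
    · rw [Finset.pair_comm]
      exact key b a p.reverse (by simpa using hp) hab.symm (by simpa using hlen)
        (fun v hv => (h1 v (by simpa using hv)).symm)
        (fun v w hv hw => h2 v w (by simpa using hv) (by simpa using hw))
        (fun v hv => h3 v (by simpa using hv)) (by simpa using hu)

/-- Strategy trees on five vertices. -/
inductive STree
  | leaf (a b c d e : Fin 5)
  | node (a b c d : Fin 5) (l r : STree)

/-- `K` is the set of claimed edges, `C` the set of Client's edges. -/
def STree.Ok : STree → ℕ → Finset (Sym2 (Fin 5)) → Finset (Sym2 (Fin 5)) → Prop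
  | .leaf a b c d e, t, K, C => t = 0 ∧ [a, b, c, d, e].Nodup ∧
      s(a, b) ∈ C ∧ s(b, c) ∈ C ∧ s(c, d) ∈ C ∧ s(d, e) ∈ C ∧
      ((K \ C).filter (fun x => e ∈ x)).card ≤ 2
  | .node _ _ _ _ _ _, 0, _, _ => False
  | .node a b c d l r, t + 1, K, C => a ≠ b ∧ c ≠ d ∧ s(a, b) ≠ s(c, d) ∧ s(a, b) ∉ K ∧
      s(c, d) ∉ K ∧ l.Ok t (K ∪ {s(a, b), s(c, d)}) (insert s(a, b) C) ∧
      r.Ok t (K ∪ {s(a, b), s(c, d)}) (insert s(c, d) C)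

instance STree.decOk : (T : STree) → (t : ℕ) → (K C : Finset (Sym2 (Fin 5))) →
    Decidable (T.Ok t K C)
  | .leaf _ _ _ _ _, _, _, _ => by unfold STree.Ok; infer_instance
  | .node _ _ _ _ _ _, 0, _, _ => by unfold STree.Ok; infer_instance
  | .node a b c d l r, t + 1, K, C => by
      have := STree.decOk l t (K ∪ {s(a, b), s(c, d)}) (insert s(a, b) C)
      have := STree.decOk r t (K ∪ {s(a, b), s(c, d)}) (insert s(c, d) C)
      unfold STree.Ok; infer_instance

/-- The explicit strategy on five vertices, found by exhaustive search. -/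
def strat : STree :=
  .node 0 1 0 2
 (.node 0 3 0 4
 (.node 1 2 1 4
 (.node 2 4 3 4
 (.leaf 4 2 1 0 3)
 (.leaf 4 3 0 1 2))
 (.node 2 3 2 4
 (.leaf 2 3 0 1 4)
 (.leaf 2 4 1 0 3)))
 (.node 1 2 1 3
 (.node 2 3 3 4
 (.leaf 3 2 1 0 4)
 (.leaf 3 4 0 1 2))
 (.node 2 3 2 4
 (.leaf 2 3 1 0 4)
 (.leaf 2 4 0 1 3))))
 (.node 0 3 0 4
 (.node 1 2 1 3
 (.node 1 4 3 4
 (.leaf 3 0 2 1 4)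
 (.leaf 1 2 0 3 4))
 (.node 1 4 2 4
 (.leaf 2 0 3 1 4)
 (.leaf 1 3 0 2 4)))
 (.node 1 2 1 4
 (.node 1 3 3 4
 (.leaf 3 1 2 0 4)
 (.leaf 1 2 0 4 3))
 (.node 1 3 2 3
 (.leaf 2 0 4 1 3)
 (.leaf 1 4 0 2 3))))

lemma strat_ok : strat.Ok 4 ∅ ∅ := by
  decide +kernel

lemma run_tree {n : ℕ} (hn : 5 ≤ n) (f : Fin 5 ↪ Fin n) : ∀ (T : STree) (t : ℕ)
    (K C : Finset (Sym2 (Fin 5))), T.Ok t K C →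
    WaiterForcesIn (HGoal n) (t + (n - 5))
      ((⊤ : SimpleGraph (Fin n)).edgeFinset \ K.map f.sym2Map) (C.map f.sym2Map) := by
  intro T
  induction T with
  | leaf a b c d e =>
    rintro t K C ⟨rfl, hnd, h1, h2, h3, h4, hb⟩
    rw [Nat.zero_add]
    have adj : ∀ x y : Fin 5, s(x, y) ∈ C → x ≠ y →
        (SimpleGraph.fromEdgeSet (↑(C.map f.sym2Map) : Set (Sym2 (Fin n)))).Adj (f x) (f y) := by
      intro x y hxy hne
      rw [SimpleGraph.fromEdgeSet_adj]
      refine ⟨?_, fun h => hne (f.injective h)⟩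
      rw [Finset.mem_coe, Finset.mem_map]
      exact ⟨_, hxy, rfl⟩
    have hall : ∀ z : Fin 5, z ∈ [a, b, c, d, e] := by
      intro z
      have h : [a, b, c, d, e].toFinset = Finset.univ := by
        apply Finset.eq_univ_of_card
        rw [List.toFinset_card_of_nodup hnd]; rfl
      have := Finset.mem_univ z
      rw [← h] at this
      simpa using this
    have hab : a ≠ b := by rintro rfl; simp at hnd
    have hbc : b ≠ c := by rintro rfl; simp at hnd
    have hcd : c ≠ d := by rintro rfl; simp at hnd
    have hde : d ≠ e := by rintro rfl; simp at hnd
    have hae : a ≠ e := by rintro rfl; simp at hnd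
    let p : (SimpleGraph.fromEdgeSet (↑(C.map f.sym2Map) : Set (Sym2 (Fin n)))).Walk (f a) (f e) :=
      .cons (adj a b h1 hab) (.cons (adj b c h2 hbc) (.cons (adj c d h3 hcd)
        (.cons (adj d e h4 hde) .nil)))
    have hsupp : p.support = [a, b, c, d, e].map f := by simp [p]
    have hout : ∀ u, u ∉ p.support → ∀ z, u ≠ f z := by
      rintro u hu z rfl
      apply hu
      rw [hsupp]
      exact List.mem_map_of_mem (hall z)
    have hnot : ∀ u, u ∉ p.support → ∀ x ∈ K.map f.sym2Map, u ∉ x := by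
      intro u hu x hx
      rw [Finset.mem_map] at hx
      obtain ⟨y, -, rfl⟩ := hx
      rw [Function.Embedding.sym2Map_apply, Sym2.mem_map]
      rintro ⟨z, -, rfl⟩
      exact hout _ hu z rfl
    have hfree : ∀ u v, u ∉ p.support → v ≠ u →
        s(v, u) ∈ (⊤ : SimpleGraph (Fin n)).edgeFinset \ K.map f.sym2Map := by
      intro u v hu hne
      rw [Finset.mem_sdiff]
      refine ⟨by simpa using hne, fun h => hnot u hu _ h (by simp)⟩
    have hsub : ((⊤ : SimpleGraph (Fin n)).edgeFinset \
        ((⊤ : SimpleGraph (Fin n)).edgeFinset \ K.map f.sym2Map)) \ C.map f.sym2Map ⊆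
        (K \ C).map f.sym2Map := by
      intro x hx
      simp only [Finset.mem_sdiff, not_and, not_not] at hx
      have hx1 := hx.1.2 hx.1.1
      rw [Finset.mem_map] at hx1 ⊢
      obtain ⟨y, hy, rfl⟩ := hx1
      refine ⟨y, ?_, rfl⟩
      rw [Finset.mem_sdiff]
      exact ⟨hy, fun h => hx.2 (Finset.mem_map_of_mem _ h)⟩
    refine extend_path (n - 5) _ _ (f a) (f e) p ?_ (fun h => hae (f.injective h)) ?_ ?_ ?_ ?_ ?_
    · rw [SimpleGraph.Walk.isPath_def, hsupp]
      exact hnd.map f.injective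
    · rw [hsupp]; simp; omega
    · intro u hu
      exact ⟨hfree u _ hu (hout u hu a).symm, hfree u _ hu (hout u hu e).symm⟩
    · intro u v hu hv huv
      exact hfree v u hv huv
    · intro u hu
      have : blueDeg n (C.map f.sym2Map)
          ((⊤ : SimpleGraph (Fin n)).edgeFinset \ K.map f.sym2Map) u = 0 := by
        unfold blueDeg
        rw [Finset.card_eq_zero, Finset.filter_eq_empty_iff]
        intro x hx
        refine hnot u hu x ?_
        exact Finset.map_subset_map.2 Finset.sdiff_subset (hsub hx)
      omega
    · unfold blueDeg
      refine le_trans (Finset.card_le_card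
        (t := ((K \ C).filter (fun x => e ∈ x)).map f.sym2Map) ?_) (by rw [Finset.card_map]; exact hb)
      intro x hx
      rw [Finset.mem_filter] at hx
      have h := hsub hx.1
      rw [Finset.mem_map] at h ⊢
      obtain ⟨y, hy, rfl⟩ := h
      refine ⟨y, ?_, rfl⟩
      rw [Finset.mem_filter]
      refine ⟨hy, ?_⟩
      have h2 := hx.2
      rw [Function.Embedding.sym2Map_apply, Sym2.mem_map] at h2
      obtain ⟨z, hz, hze⟩ := h2
      rwa [← f.injective hze]
  | node a b c d l r ihl ihr =>
    intro t K C h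
    cases t with
    | zero => exact h.elim
    | succ t =>
      obtain ⟨hab, hcd, hne, hK1, hK2, hl, hr⟩ := h
      have hl' := ihl _ _ _ hl
      have hr' := ihr _ _ _ hr
      have hfr : ∀ x y : Fin 5, x ≠ y → s(x, y) ∉ K → s(f x, f y) ∈
          (⊤ : SimpleGraph (Fin n)).edgeFinset \ K.map f.sym2Map := by
        intro x y hxy hK
        rw [Finset.mem_sdiff]
        refine ⟨by simpa using hxy, ?_⟩
        intro h
        apply hK
        exact (Finset.mem_map' f.sym2Map).1 h
      have hset : (⊤ : SimpleGraph (Fin n)).edgeFinset \ (K ∪ {s(a, b), s(c, d)}).map f.sym2Map =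
          ((⊤ : SimpleGraph (Fin n)).edgeFinset \ K.map f.sym2Map) \
            {s(f a, f b), s(f c, f d)} := by
        rw [Finset.map_union, Finset.map_insert, Finset.map_singleton, sdiff_sdiff_left]
        rfl
      rw [hset, Finset.map_insert] at hl' hr'
      rw [Nat.add_right_comm]
      refine .offer s(f a, f b) s(f c, f d) (hfr a b hab hK1) (hfr c d hcd hK2) ?_ hl' hr'
      intro h
      exact hne (f.sym2Map.injective h)

/-- for `n ≥ 5`, in the unbiased Waiter-Client game on `K_n`,
Waiter can force, within `n−1` rounds, Client's (red) graph to contain a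
Hamilton path one of whose endpoints is incident with at most two of Waiter's
(blue) edges.  Here the blue edges are the claimed edges not kept by Client. -/
theorem stmt_4 (n : ℕ) (hn : 5 ≤ n) :
    WaiterForcesIn
      (fun client free =>
        ∃ (a b : Fin n)
          (p : (SimpleGraph.fromEdgeSet (↑client : Set (Sym2 (Fin n)))).Walk a b),
          p.IsHamiltonian ∧
          ((((⊤ : SimpleGraph (Fin n)).edgeFinset \ free) \ client).filter
              (fun e => b ∈ e)).card ≤ 2)
      (n - 1) ((⊤ : SimpleGraph (Fin n)).edgeFinset) ∅ := by
  have h := run_tree hn (Fin.castLEEmb hn) strat 4 ∅ ∅ strat_ok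
  rw [Finset.map_empty, Finset.sdiff_empty,
    show 4 + (n - 5) = n - 1 by omega] at h
  exact h
end

section
/- Consider a Waiter-Client game on a hypergraph (X, 𝓕). If Σ_{F ∈ 𝓕} 2^{−|F|+1} < 1, then Waiter has a strategy to force Client to claim at least one element in each set of 𝓕. -/
open scoped Classical

/-- `WaiterForcesEnd goal free client`: in the unbiased Waiter-Client game with
unclaimed set `free` and Client's set `client`, Waiter can guarantee, against
any play of Client, that at the end of the game (when at most one unclaimed
element remains, and it goes to Waiter) `goal` holds for Client's final set. -/
inductive WaiterForcesEnd {α : Type*} [DecidableEq α]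
    (goal : Finset α → Prop) : Finset α → Finset α → Prop
  | win {free client : Finset α} :
      free.card ≤ 1 → goal client → WaiterForcesEnd goal free client
  | offer {free client : Finset α} (e₁ e₂ : α)
      (h₁ : e₁ ∈ free) (h₂ : e₂ ∈ free) (hne : e₁ ≠ e₂)
      (hc₁ : WaiterForcesEnd goal (free \ {e₁, e₂}) (insert e₁ client))
      (hc₂ : WaiterForcesEnd goal (free \ {e₁, e₂}) (insert e₂ client)) :
      WaiterForcesEnd goal free client

/-- Danger of a single set. -/
noncomputable def wcTerm {X : Type*} [DecidableEq X] (F S C : Finset X) : ℝ :=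
  if Disjoint F C then (1 / 2 : ℝ) ^ (F ∩ S).card else 0

/-- Total danger. -/
noncomputable def wcPot {X : Type*} [DecidableEq X] (𝓕 : Finset (Finset X))
    (S C : Finset X) : ℝ := ∑ F ∈ 𝓕, wcTerm F S C

theorem wcTerm_nonneg {X : Type*} [DecidableEq X] (F S C : Finset X) : 0 ≤ wcTerm F S C := by
  unfold wcTerm; split_ifs <;> positivity

theorem wcTerm_erase_mem {X : Type*} [DecidableEq X] {F S : Finset X} (C : Finset X) {x : X}
    (hS : x ∈ S) (hF : x ∈ F) : wcTerm F (S.erase x) C = 2 * wcTerm F S C := by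
  unfold wcTerm
  have h : (F ∩ S).card = (F ∩ S.erase x).card + 1 := by
    rw [Finset.inter_erase, Finset.card_erase_add_one (Finset.mem_inter.2 ⟨hF, hS⟩)]
  rw [h]
  split_ifs
  · rw [pow_succ]; ring
  · simp

theorem wcTerm_erase_notMem {X : Type*} [DecidableEq X] {F : Finset X} (S C : Finset X) {x : X}
    (hF : x ∉ F) : wcTerm F (S.erase x) C = wcTerm F S C := by
  unfold wcTerm
  have h : F ∩ S.erase x = F ∩ S := by
    ext a; simp only [Finset.mem_inter, Finset.mem_erase]
    constructor
    · tauto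
    · rintro ⟨h1, h2⟩
      exact ⟨h1, fun h => hF (h ▸ h1), h2⟩
  rw [h]

theorem wcTerm_insert_mem {X : Type*} [DecidableEq X] {F : Finset X} (S C : Finset X) {x : X}
    (hF : x ∈ F) : wcTerm F S (insert x C) = 0 := by
  unfold wcTerm
  rw [if_neg]
  simp [Finset.disjoint_insert_right, hF]

theorem wcTerm_insert_notMem {X : Type*} [DecidableEq X] {F : Finset X} (S C : Finset X) {x : X}
    (hF : x ∉ F) : wcTerm F S (insert x C) = wcTerm F S C := by
  unfold wcTerm
  simp [Finset.disjoint_insert_right, hF]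

theorem wcPot_insert_le {X : Type*} [DecidableEq X] (𝓕 : Finset (Finset X))
    (S C : Finset X) (x : X) :
    wcPot 𝓕 (S.erase x) (insert x C) ≤ wcPot 𝓕 S C := by
  unfold wcPot
  refine Finset.sum_le_sum fun F _ => ?_
  by_cases hF : x ∈ F
  · rw [wcTerm_insert_mem _ _ hF]; exact wcTerm_nonneg _ _ _
  · rw [wcTerm_insert_notMem _ _ hF, wcTerm_erase_notMem _ _ hF]

theorem wcPot_key {X : Type*} [DecidableEq X] (𝓕 : Finset (Finset X))
    (S C : Finset X) {x v : X} (hx : x ∈ S) (hv : v ∈ S.erase x) :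
    wcPot 𝓕 ((S.erase x).erase v) (insert x C) + wcPot 𝓕 (S.erase x) C
      ≤ wcPot 𝓕 (S.erase v) C + wcPot 𝓕 S C := by
  unfold wcPot
  rw [← Finset.sum_add_distrib, ← Finset.sum_add_distrib]
  refine Finset.sum_le_sum fun F _ => ?_
  have h0 := wcTerm_nonneg F S C
  have hvS := Finset.mem_of_mem_erase hv
  by_cases hF : x ∈ F
  · rw [wcTerm_insert_mem _ _ hF, wcTerm_erase_mem _ hx hF]
    by_cases hG : v ∈ F
    · rw [wcTerm_erase_mem _ hvS hG]; linarith
    · rw [wcTerm_erase_notMem _ _ hG]; linarith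
  · rw [wcTerm_insert_notMem _ _ hF, wcTerm_erase_notMem _ _ hF]
    by_cases hG : v ∈ F
    · rw [wcTerm_erase_mem _ hv hG, wcTerm_erase_mem _ hvS hG, wcTerm_erase_notMem _ _ hF]
    · rw [wcTerm_erase_notMem _ _ hG, wcTerm_erase_notMem _ _ hG, wcTerm_erase_notMem _ _ hF]

theorem wc_step {X : Type*} [DecidableEq X] (𝓕 : Finset (Finset X))
    (S C : Finset X) {x y : X} (hx : x ∈ S) (hy : y ∈ S) (hne : x ≠ y)
    (hinv : ∀ v ∈ S, wcPot 𝓕 (S.erase v) C < 1)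
    (hmax : ∀ v ∈ S, v ≠ y →
      wcPot 𝓕 ((S.erase y).erase v) C ≤ wcPot 𝓕 ((S.erase y).erase x) C) :
    wcPot 𝓕 ((S.erase y).erase x) (insert x C) < 1 ∧
      ∀ v ∈ (S.erase y).erase x,
        wcPot 𝓕 (((S.erase y).erase x).erase v) (insert x C) < 1 := by
  refine ⟨(wcPot_insert_le 𝓕 _ C x).trans_lt (hinv y hy), fun v hv => ?_⟩
  have h1 := wcPot_key 𝓕 (S.erase y) C (Finset.mem_erase.2 ⟨hne, hx⟩) hv
  have hv' := Finset.mem_erase.1 (Finset.mem_of_mem_erase hv)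
  have h2 := hmax v hv'.2 hv'.1
  have h3 := hinv y hy
  linarith

theorem wc_main {X : Type*} [DecidableEq X] (𝓕 : Finset (Finset X)) (n : ℕ) :
    ∀ S C : Finset X, S.card = n → wcPot 𝓕 S C < 1 →
      (∀ v ∈ S, wcPot 𝓕 (S.erase v) C < 1) →
      WaiterForcesEnd (fun client => ∀ F ∈ 𝓕, ∃ x ∈ F, x ∈ client) S C := by
  induction n using Nat.strong_induction_on with
  | _ n ih =>
  intro S C hn h0 hinv
  by_cases hc : S.card ≤ 1
  · refine WaiterForcesEnd.win hc ?_
    have hE : wcPot 𝓕 ∅ C < 1 := by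
      rcases Nat.le_one_iff_eq_zero_or_eq_one.1 hc with h | h
      · rw [Finset.card_eq_zero] at h; rwa [h] at h0
      · obtain ⟨a, rfl⟩ := Finset.card_eq_one.1 h
        simpa using hinv a (by simp)
    intro F hF
    by_contra hcon
    have hd : Disjoint F C := by
      rw [Finset.disjoint_left]
      intro a ha hb
      exact hcon ⟨a, ha, hb⟩
    have h1 : wcTerm F ∅ C ≤ wcPot 𝓕 ∅ C :=
      Finset.single_le_sum (f := fun F => wcTerm F ∅ C)
        (fun G _ => wcTerm_nonneg G ∅ C) hF
    have h2 : wcTerm F ∅ C = 1 := by simp [wcTerm, hd]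
    linarith
  · have hne : S.offDiag.Nonempty := by
      rw [not_le, Finset.one_lt_card] at hc
      obtain ⟨a, ha, b, hb, hab⟩ := hc
      exact ⟨(a, b), Finset.mem_offDiag.2 ⟨ha, hb, hab⟩⟩
    obtain ⟨⟨x, y⟩, hp, hmax⟩ := Finset.exists_max_image S.offDiag
      (fun p => wcPot 𝓕 ((S.erase p.2).erase p.1) C) hne
    obtain ⟨hx, hy, hxy⟩ := Finset.mem_offDiag.1 hp
    simp only at hx hy hxy hmax
    have e1 : S \ {x, y} = (S.erase y).erase x := by
      ext a; simp only [Finset.mem_sdiff, Finset.mem_insert, Finset.mem_singleton,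
        Finset.mem_erase]; tauto
    have e2 : S \ {x, y} = (S.erase x).erase y := by
      rw [e1, Finset.erase_right_comm]
    have hcard : (S \ {x, y}).card < n := by
      rw [← hn]
      refine Finset.card_lt_card (Finset.ssubset_iff_of_subset Finset.sdiff_subset |>.2
        ⟨x, hx, by simp⟩)
    refine WaiterForcesEnd.offer x y hx hy hxy ?_ ?_
    · have h := wc_step 𝓕 S C hx hy hxy hinv
        (fun v hv hvy => hmax (v, y) (Finset.mem_offDiag.2 ⟨hv, hy, hvy⟩))
      rw [← e1] at h
      exact ih _ hcard _ _ rfl h.1 h.2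
    · have h := wc_step 𝓕 S C hy hx hxy.symm hinv
        (fun v hv hvx => by
          rw [← e2, e1]
          exact hmax (v, x) (Finset.mem_offDiag.2 ⟨hv, hx, hvx⟩))
      rw [← e2] at h
      exact ih _ hcard _ _ rfl h.1 h.2

/-- in the Waiter-Client game on a hypergraph `(X, 𝓕)` with
`∑_{F ∈ 𝓕} 2^{−|F|+1} < 1`, Waiter has a strategy to force Client to claim at
least one element of every set in `𝓕`. -/
theorem stmt_7 {X : Type*} [Fintype X] [DecidableEq X]
    (𝓕 : Finset (Finset X))
    (hsum : ∑ F ∈ 𝓕, (2 : ℝ) ^ (1 - (F.card : ℤ)) < 1) :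
    WaiterForcesEnd
      (fun client => ∀ F ∈ 𝓕, ∃ x ∈ F, x ∈ client)
      (Finset.univ : Finset X) ∅ := by
  have hterm : ∀ F : Finset X,
      (2 : ℝ) ^ (1 - (F.card : ℤ)) = 2 * wcTerm F Finset.univ ∅ := by
    intro F
    rw [zpow_sub₀ (by norm_num)]
    simp [wcTerm, div_eq_mul_inv]
  have h2 : 2 * wcPot 𝓕 Finset.univ ∅ < 1 := by
    unfold wcPot
    rw [Finset.mul_sum]
    simpa only [hterm] using hsum
  have h0 : 0 ≤ wcPot 𝓕 Finset.univ ∅ :=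
    Finset.sum_nonneg fun F _ => wcTerm_nonneg F _ _
  refine wc_main 𝓕 _ _ _ rfl (by linarith) fun v hv => lt_of_le_of_lt ?_ h2
  unfold wcPot
  rw [Finset.mul_sum]
  refine Finset.sum_le_sum fun F _ => ?_
  by_cases hF : v ∈ F
  · rw [wcTerm_erase_mem _ hv hF]
  · rw [wcTerm_erase_notMem _ _ hF]
    have := wcTerm_nonneg F Finset.univ ∅
    linarith
end
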